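/- arXiv:math/9906082 — 3 statements merged into one kernel-verified Lean document; each statement's English description precedes it below -/
import Mathlib

section
/- Let A be a C*-algebra with an approximate unit (e_α), and let W be a contractive Banach left A-module such that e_α • w → w in norm for every w ∈ W. Let T : A → W be a bounded A-module map (T(ab) = a • T(b) for all a, b ∈ A). Then there exists w ∈ W with T = r_w (i.e. T(a) = a • w for all a) if and only if the net of maps a ↦ a • T(e_α) converges to T in operator norm, i.e. ‖T − r_{T(e_α)}‖ → 0. Hence W is isometrically isomorphic, via w ↦ r_w, to the set of bounded A-module maps T : A → W satisfying ‖T − r_{T(e_α)}‖ → 0. -/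
open Filter Topology

/-- Let `A` be a C*-algebra with an approximate unit `(e_α)`, and let `W` be a
contractive Banach left `A`-module (action given by the bilinear map `m`) such that
`e_α • w → w` in norm for every `w ∈ W`.  With `r_w : A → W` the bounded map `a ↦ a • w`,
a bounded `A`-module map `T : A → W` is of the form `r_w` for some `w ∈ W` if and only if
`‖T − r_{T(e_α)}‖ → 0` in operator norm.  Hence `W` is isometrically isomorphic, via
`w ↦ r_w`, to the set of bounded `A`-module maps `T` with `‖T − r_{T(e_α)}‖ → 0`. -/
theorem stmt1 {A : Type*} [NonUnitalNormedRing A] [StarRing A] [CStarRing A]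
    [NormedSpace ℂ A] [IsScalarTower ℂ A A] [SMulCommClass ℂ A A] [CompleteSpace A]
    [PartialOrder A] [StarOrderedRing A]
    {W : Type*} [NormedAddCommGroup W] [NormedSpace ℂ W] [CompleteSpace W]
    (m : A →ₗ[ℂ] W →ₗ[ℂ] W)
    (hmul : ∀ (a b : A) (w : W), m (a * b) w = m a (m b w))
    (hcontr : ∀ (a : A) (w : W), ‖m a w‖ ≤ ‖a‖ * ‖w‖)
    {ι : Type*} [Nonempty ι] [SemilatticeSup ι] (e : ι → A)
    (he_pos : ∀ i, 0 ≤ e i) (he_norm : ∀ i, ‖e i‖ ≤ 1)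
    (he_left : ∀ a : A, Tendsto (fun i => e i * a) atTop (𝓝 a))
    (he_right : ∀ a : A, Tendsto (fun i => a * e i) atTop (𝓝 a))
    (he_mod : ∀ w : W, Tendsto (fun i => m (e i) w) atTop (𝓝 w))
    -- `r w` is the bounded linear map `a ↦ a • w = m a w`
    (r : W → (A →L[ℂ] W)) (hr : ∀ (w : W) (a : A), r w a = m a w) :
    (∀ w : W, ‖r w‖ = ‖w‖) ∧
    ∀ T : A →L[ℂ] W, (∀ a b : A, T (a * b) = m a (T b)) →
      ((∃ w : W, T = r w) ↔
        Tendsto (fun i => ‖T - r (T (e i))‖) atTop (𝓝 0)) := by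
  have hnorm (w : W) : ‖r w‖ = ‖w‖ := by
    refine le_antisymm ((r w).opNorm_le_bound (norm_nonneg w) fun a => ?_) ?_
    · rw [hr, mul_comm]
      exact hcontr a w
    · refine le_of_tendsto (he_mod w).norm (Eventually.of_forall fun i => ?_)
      rw [← hr]
      exact (r w).unit_le_opNorm _ (he_norm i)
  let R : W →ₗᵢ[ℂ] (A →L[ℂ] W) :=
    { toFun := r
      map_add' := fun v w => by ext a; simp [hr]
      map_smul' := fun c w => by ext a; simp [hr]
      norm_map' := hnorm }
  refine ⟨hnorm, fun T _ => ⟨?_, fun h => ?_⟩⟩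
  · rintro ⟨w, rfl⟩
    have key (i : ι) : ‖r w - r (r w (e i))‖ = ‖m (e i) w - w‖ := by
      have h1 : r w - r (r w (e i)) = R (w - r w (e i)) := (map_sub R _ _).symm
      rw [h1, R.norm_map, hr, norm_sub_rev]
    simp_rw [key]
    exact tendsto_iff_norm_sub_tendsto_zero.mp (he_mod w)
  · have hT : Tendsto (fun i => R (T (e i))) atTop (𝓝 T) := by
      rw [tendsto_iff_norm_sub_tendsto_zero]
      exact h.congr fun i => norm_sub_rev _ _
    obtain ⟨w, hw⟩ := R.isometry.isClosedEmbedding.isClosed_range.mem_of_tendsto hT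
      (Eventually.of_forall fun i => Set.mem_range_self _)
    exact ⟨w, hw.symm⟩
end

section
/- Let A be a C*-algebra and π : A → B(H) a nondegenerate *-representation of A on a complex Hilbert space H (i.e. the closed linear span of {π(a)ξ : a ∈ A, ξ ∈ H} is all of H). Then for every bounded linear map T : A → H satisfying T(ab) = π(a) T(b) for all a, b ∈ A, there exists a unique vector ζ ∈ H such that T(a) = π(a) ζ for all a ∈ A, and moreover ‖T‖ = ‖ζ‖. Consequently the map ζ ↦ (a ↦ π(a)ζ) is an isometric linear isomorphism from H onto the space of all bounded A-module maps from A to H. -/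
open Filter Topology

open ComplexConjugate

section CStarAlgebra

variable {A : Type*} [NonUnitalCStarAlgebra A]

variable (A) in
/-- Every C⋆-algebra has a contractive approximate unit. -/
theorem exists_isApproximateUnit_norm_le_one :
    ∃ l : Filter A, l.IsApproximateUnit ∧ ∀ᶠ x in l, ‖x‖ ≤ 1 := by
  let _ := CStarAlgebra.spectralOrder A
  let _ := CStarAlgebra.spectralOrderedRing A
  have h := CStarAlgebra.increasingApproximateUnit A
  exact ⟨_, h.toIsApproximateUnit, h.eventually_norm⟩

variable {H : Type*} [NormedAddCommGroup H] [InnerProductSpace ℂ H] [CompleteSpace H]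

theorem norm_apply_le_of_representation (π : A →⋆ₙₐ[ℂ] (H →L[ℂ] H)) (a : A) : ‖π a‖ ≤ ‖a‖ :=
  NonUnitalStarAlgHom.norm_apply_le π a

/-- A bounded module map from a C⋆-algebra to a Hilbert space is given by evaluation at a vector
whose norm is at most that of the map. -/
theorem exists_norm_le_and_forall_eq_apply (π : A →⋆ₙₐ[ℂ] (H →L[ℂ] H)) (T : A →L[ℂ] H)
    (hT : ∀ a b : A, T (a * b) = π a (T b)) :
    ∃ ζ : H, ‖ζ‖ ≤ ‖T‖ ∧ ∀ a : A, T a = π a ζ := by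
  obtain ⟨l, hl, hl1⟩ := exists_isApproximateUnit_norm_le_one A
  have := hl.neBot
  let U := Ultrafilter.of l
  have hU : (U : Filter A) ≤ l := Ultrafilter.of_le l
  let f : A → WeakDual ℂ H := fun x ↦ StrongDual.toWeakDual (InnerProductSpace.toDual ℂ H (T x))
  have hf : ∀ᶠ x in (U : Filter A),
      f x ∈ WeakDual.toStrongDual ⁻¹' Metric.closedBall (0 : StrongDual ℂ H) ‖T‖ := by
    filter_upwards [hU hl1] with x hx
    have hx' : ‖InnerProductSpace.toDual ℂ H (T x)‖ ≤ ‖T‖ := by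
      rw [LinearIsometryEquiv.norm_map]
      exact T.unit_le_opNorm x hx
    exact mem_closedBall_zero_iff.mpr hx'
  obtain ⟨φ, hφ, hlim⟩ := (WeakDual.isCompact_closedBall (0 : StrongDual ℂ H) ‖T‖)
    |>.ultrafilter_le_nhds (U.map f) (Filter.le_principal_iff.mpr hf)
  let ζ := (InnerProductSpace.toDual ℂ H).symm (WeakDual.toStrongDual φ)
  have hζ (η : H) : Tendsto (fun x ↦ inner ℂ (T x) η) U (𝓝 (inner ℂ ζ η)) := by
    have h1 : Tendsto (fun x ↦ f x η) U (𝓝 (φ η)) :=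
      (WeakDual.eval_continuous η).continuousAt.tendsto.comp hlim
    have h2 : inner ℂ ζ η = φ η := InnerProductSpace.toDual_symm_apply
    rw [h2]
    exact h1
  refine ⟨ζ, ?_, fun a ↦ ext_inner_right ℂ fun η ↦ ?_⟩
  · rw [LinearIsometryEquiv.norm_map]
    exact mem_closedBall_zero_iff.mp hφ
  · have h1 : Tendsto (fun x ↦ inner ℂ (T (a * x)) η) U (𝓝 (inner ℂ (T a) η)) :=
      ((T.continuous.tendsto a).comp ((hl.tendsto_mul_left a).mono_left hU)).inner
        tendsto_const_nhds
    have h2 := hζ (ContinuousLinearMap.adjoint (π a) η)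
    simp only [ContinuousLinearMap.adjoint_inner_right, ← hT] at h2
    exact tendsto_nhds_unique h1 h2

end CStarAlgebra

section Nondegenerate

variable {A : Type*} [NonUnitalNormedRing A] [StarRing A] [NormedSpace ℂ A]
  {H : Type*} [NormedAddCommGroup H] [InnerProductSpace ℂ H] [CompleteSpace H]

theorem eq_zero_of_forall_apply_eq_zero (π : A →⋆ₙₐ[ℂ] (H →L[ℂ] H))
    (hnondeg : Dense (↑(Submodule.span ℂ {x : H | ∃ (a : A) (ξ : H), x = π a ξ}) : Set H))
    {η : H} (h : ∀ a : A, π a η = 0) : η = 0 := by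
  refine hnondeg.eq_zero_of_inner_left (𝕜 := ℂ) fun v hv ↦ ?_
  induction hv using Submodule.span_induction with
  | mem x hx =>
    obtain ⟨a, ξ, rfl⟩ := hx
    rw [← ContinuousLinearMap.adjoint_inner_left, ← ContinuousLinearMap.star_eq_adjoint,
      ← map_star, h, inner_zero_left]
  | zero => exact inner_zero_right _
  | add x y _ _ hx hy => rw [inner_add_right, hx, hy, add_zero]
  | smul c x _ hx => rw [inner_smul_right, hx, mul_zero]

end Nondegenerate

section LinearStar

/-! A complex Banach ring with a C⋆-norm whose star operation is not assumed conjugate-linear is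
the sum of two mutually annihilating parts, on which the star is conjugate-linear and linear,
respectively. -/

variable {A : Type*} [NonUnitalNormedRing A] [StarRing A] [NormedSpace ℂ A]

theorem smul_I_eq_zero_of_eq_neg {E : Type*} [AddCommGroup E] [Module ℂ E] {x : E}
    (h : Complex.I • x = -(Complex.I • x)) : x = 0 := by
  have h2 : (2 * Complex.I) • x = 0 := by
    rw [two_mul, add_smul]
    nth_rewrite 1 [h]
    exact neg_add_cancel _
  exact (smul_eq_zero.mp h2).resolve_left (by simp)

theorem star_ofReal_smul [CStarRing A] (r : ℝ) (a : A) :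
    star ((r : ℂ) • a) = (r : ℂ) • star a := by
  simpa using map_real_smul (starAddEquiv : A ≃+ A) continuous_star r a

theorem star_smul_of_star_I_smul [CStarRing A] {a : A}
    (h : star (Complex.I • a) = -(Complex.I • star a)) (z : ℂ) :
    star (z • a) = conj z • star a := by
  have h1 : star (z • a) = (z.re : ℂ) • star a + (z.im : ℂ) • star (Complex.I • a) := by
    conv_lhs => rw [← Complex.re_add_im z, add_smul, mul_smul, star_add]
    rw [star_ofReal_smul, star_ofReal_smul]
  have h2 : conj z = z.re - z.im * Complex.I := by
    apply Complex.ext <;> simp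
  rw [h1, h, h2, sub_smul, mul_smul, smul_neg, sub_eq_add_neg]

theorem map_eq_zero_of_linear {B : Type*} [NonUnitalRing B] [StarRing B] [Module ℂ B]
    [StarModule ℂ B] (π : A →⋆ₙₐ[ℂ] B) {k : A}
    (hk : star (Complex.I • k) = Complex.I • star k) : π k = 0 := by
  rw [← star_eq_zero]
  apply smul_I_eq_zero_of_eq_neg
  calc Complex.I • star (π k) = π (star (Complex.I • k)) := by rw [hk, map_smul, map_star]
    _ = -(Complex.I • star (π k)) := by
        rw [map_star, map_smul, star_smul, Complex.star_def, Complex.conj_I, neg_smul]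

variable [IsScalarTower ℂ A A] [SMulCommClass ℂ A A]

variable (A) in
/-- The largest star subalgebra on which the star operation is conjugate-linear. -/
def conjLinearPart : NonUnitalStarSubalgebra ℂ A where
  carrier := {a | ∀ z : ℂ, star (z • a) = conj z • star a}
  add_mem' ha hb z := by rw [smul_add, star_add, ha z, hb z, star_add, smul_add]
  zero_mem' z := by simp
  mul_mem' {a b} ha _ z := by rw [← smul_mul_assoc, star_mul, ha z, star_mul, mul_smul_comm]
  smul_mem' c a ha z := by rw [smul_smul, ha, ha, map_mul, mul_smul]
  star_mem' {a} ha z := by rw [← star_inj, star_star, star_star, ha, Complex.conj_conj]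

theorem mem_conjLinearPart {a : A} :
    a ∈ conjLinearPart A ↔ ∀ z : ℂ, star (z • a) = conj z • star a := Iff.rfl

theorem isClosed_conjLinearPart [CStarRing A] : IsClosed (conjLinearPart A : Set A) := by
  have h : (conjLinearPart A : Set A) = ⋂ z : ℂ, {a | star (z • a) = conj z • star a} := by
    ext a
    simp [mem_conjLinearPart]
  rw [h]
  exact isClosed_iInter fun z ↦ isClosed_eq (by fun_prop) (by fun_prop)

noncomputable instance [CStarRing A] [CompleteSpace A] :
    NonUnitalCStarAlgebra (conjLinearPart A) where
  toCompleteSpace := isClosed_conjLinearPart.completeSpace_coe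
  norm_mul_self_le x := CStarRing.norm_star_mul_self (x := (x : A)) |>.symm.le
  star_smul z a := Subtype.ext (a.2 z)

/-- Conjugating multiplication by `I` by the star operation commutes with multiplication
by `I`. -/
theorem star_I_smul_star_I_smul [CStarRing A] (a : A) :
    star (Complex.I • star (Complex.I • a)) = Complex.I • star (Complex.I • star a) := by
  have hl (x y : A) : star (Complex.I • star (x * y)) = star (Complex.I • star x) * y := by
    rw [star_mul, ← mul_smul_comm, star_mul, star_star]
  have hr (x y : A) : star (Complex.I • star (x * y)) = x * star (Complex.I • star y) := by
    rw [star_mul, ← smul_mul_assoc, star_mul, star_star]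
  have h (b : A) : (star (Complex.I • star (Complex.I • a)) -
      Complex.I • star (Complex.I • star a)) * b = 0 := by
    rw [sub_mul, smul_mul_assoc, ← hl, ← hl, hr, hr, smul_mul_assoc, sub_self]
  exact sub_eq_zero.mp (CStarRing.mul_star_self_eq_zero_iff _ |>.mp (h _))

theorem exists_conjLinear_add_linear [CStarRing A] (a : A) :
    ∃ j ∈ conjLinearPart A, ∃ k : A, star (Complex.I • k) = Complex.I • star k ∧ a = j + k := by
  have hI (x : A) : Complex.I • Complex.I • x = -x := by
    rw [smul_smul, Complex.I_mul_I, neg_one_smul]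
  have hhalf (x : A) : star ((2⁻¹ : ℂ) • x) = (2⁻¹ : ℂ) • star x := by
    simpa using star_ofReal_smul 2⁻¹ x
  set t := star (Complex.I • star a) with ht
  have hst : star t = Complex.I • star a := star_star _
  have hsIt : star (Complex.I • t) = Complex.I • star (Complex.I • a) := by
    rw [ht, ← star_I_smul_star_I_smul, star_star]
  refine ⟨(2⁻¹ : ℂ) • (a + Complex.I • t), ?_, (2⁻¹ : ℂ) • (a - Complex.I • t), ?_, ?_⟩
  · refine SMulMemClass.smul_mem _ (star_smul_of_star_I_smul ?_)
    rw [smul_add, hI, star_add, star_neg, hst, star_add, hsIt, smul_add, hI]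
    abel
  · rw [smul_comm, hhalf, hhalf, smul_comm Complex.I]
    congr 1
    rw [smul_sub, hI, sub_neg_eq_add, star_add, hst, star_sub, hsIt, smul_sub, hI]
    abel
  · rw [← smul_add, add_add_sub_cancel, ← two_smul ℂ a, smul_smul]
    norm_num

theorem mul_eq_zero_of_conjLinear_of_linear {j k : A} (hj : j ∈ conjLinearPart A)
    (hk : star (Complex.I • k) = Complex.I • star k) : j * k = 0 := by
  rw [← star_eq_zero]
  apply smul_I_eq_zero_of_eq_neg
  calc Complex.I • star (j * k) = star (j * (Complex.I • k)) := by
        rw [star_mul, star_mul, hk, smul_mul_assoc]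
    _ = star ((Complex.I • j) * k) := by rw [mul_smul_comm, smul_mul_assoc]
    _ = -(Complex.I • star (j * k)) := by
        rw [star_mul, hj, star_mul, mul_smul_comm, Complex.conj_I, neg_smul]

theorem norm_le_norm_add_of_conjLinear_of_linear [CStarRing A] {j k : A}
    (hj : j ∈ conjLinearPart A) (hk : star (Complex.I • k) = Complex.I • star k) :
    ‖j‖ ≤ ‖j + k‖ := by
  rcases (norm_nonneg j).eq_or_lt with h0 | h0
  · rw [← h0]
    exact norm_nonneg _
  · refine le_of_mul_le_mul_left ?_ h0
    calc ‖j‖ * ‖j‖ = ‖star j * (j + k)‖ := by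
          rw [mul_add, mul_eq_zero_of_conjLinear_of_linear (star_mem hj) hk, add_zero,
            CStarRing.norm_star_mul_self]
      _ ≤ ‖j‖ * ‖j + k‖ := by simpa using norm_mul_le (star j) (j + k)

end LinearStar

/-- Let `A` be a C*-algebra and `π : A → B(H)` a nondegenerate *-representation
of `A` on a complex Hilbert space `H`.  Then for every bounded linear map `T : A → H`
satisfying `T (a b) = π a (T b)` there is a unique vector `ζ ∈ H` with `T a = π a ζ` for all
`a`, and moreover `‖T‖ = ‖ζ‖`.  Consequently `ζ ↦ (a ↦ π a ζ)` is an isometric linear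
isomorphism from `H` onto the space of bounded `A`-module maps from `A` to `H`. -/
theorem stmt2 {A : Type*} [NonUnitalNormedRing A] [StarRing A] [CStarRing A]
    [NormedSpace ℂ A] [IsScalarTower ℂ A A] [SMulCommClass ℂ A A] [CompleteSpace A]
    {H : Type*} [NormedAddCommGroup H] [InnerProductSpace ℂ H] [CompleteSpace H]
    (π : A →⋆ₙₐ[ℂ] (H →L[ℂ] H))
    (hnondeg : Dense (↑(Submodule.span ℂ {x : H | ∃ (a : A) (ξ : H), x = π a ξ}) : Set H)) :
    ∀ T : A →L[ℂ] H, (∀ a b : A, T (a * b) = π a (T b)) →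
      (∃! ζ : H, ∀ a : A, T a = π a ζ) ∧
      (∀ ζ : H, (∀ a : A, T a = π a ζ) → ‖T‖ = ‖ζ‖) := by
  intro T hT
  have hT0 {k : A} (hk : star (Complex.I • k) = Complex.I • star k) : T k = 0 := by
    refine eq_zero_of_forall_apply_eq_zero π hnondeg fun a ↦ ?_
    obtain ⟨j, hj, k', hk', rfl⟩ := exists_conjLinear_add_linear a
    rw [map_add, map_eq_zero_of_linear π hk', add_zero, ← hT,
      mul_eq_zero_of_conjLinear_of_linear hj hk, map_zero]
  let J := conjLinearPart A
  let ι : J →L[ℂ] A := J.toSubmodule.subtypeL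
  let πJ : J →⋆ₙₐ[ℂ] (H →L[ℂ] H) := π.comp (NonUnitalStarSubalgebraClass.subtype J)
  have hι : ‖ι‖ ≤ 1 := J.toSubmodule.norm_subtypeL_le
  obtain ⟨ζ, hζ, hTζ⟩ := exists_norm_le_and_forall_eq_apply πJ (T.comp ι) fun a b ↦ hT a b
  have hTζ' (a : A) : T a = π a ζ := by
    obtain ⟨j, hj, k, hk, rfl⟩ := exists_conjLinear_add_linear a
    rw [map_add, hT0 hk, map_add, map_eq_zero_of_linear π hk, add_zero, add_zero]
    exact hTζ ⟨j, hj⟩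
  have huniq (ξ : H) (hξ : ∀ a : A, T a = π a ξ) : ξ = ζ := by
    refine sub_eq_zero.mp (eq_zero_of_forall_apply_eq_zero π hnondeg fun a ↦ ?_)
    rw [map_sub, ← hξ, ← hTζ', sub_self]
  refine ⟨⟨ζ, hTζ', huniq⟩, fun ξ hξ ↦ ?_⟩
  rw [huniq ξ hξ]
  refine le_antisymm (T.opNorm_le_bound (norm_nonneg _) fun a ↦ ?_) ?_
  · obtain ⟨j, hj, k, hk, rfl⟩ := exists_conjLinear_add_linear a
    have hπj : ‖π j‖ ≤ ‖j‖ := norm_apply_le_of_representation πJ ⟨j, hj⟩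
    rw [hTζ', map_add, map_eq_zero_of_linear π hk, add_zero, mul_comm]
    exact (π j).le_of_opNorm_le
      (hπj.trans (norm_le_norm_add_of_conjLinear_of_linear hj hk)) ζ
  · calc ‖ζ‖ ≤ ‖T.comp ι‖ := hζ
      _ ≤ ‖T‖ * ‖ι‖ := T.opNorm_comp_le ι
      _ ≤ ‖T‖ := mul_le_of_le_one_right (norm_nonneg _) hι
end

section
/- Let H and K be complex Hilbert spaces, let A ⊆ B(H) and B ⊆ B(K) be C*-subalgebras, and let X ⊆ B(K, H) be a norm-closed linear subspace such that: (i) aS ∈ X for all a ∈ A, S ∈ X; (ii) Sb ∈ X for all S ∈ X, b ∈ B; (iii) S₁* S₂ ∈ B for all S₁, S₂ ∈ X; (iv) the closed linear span of {aS : a ∈ A, S ∈ X} equals X. Suppose moreover there is a set Y ⊆ B(H, K) such that the closed linear span of {S R : S ∈ X, R ∈ Y} equals A. Then S₁ S₂* ∈ A for all S₁, S₂ ∈ X. -/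
/-- A continuous linear map which sends a set `s` into a closed submodule `p` sends the closed
span of `s` into `p`. -/
theorem ContinuousLinearMap.map_mem_of_mem_closure_span {R E F : Type*} [Semiring R]
    [AddCommMonoid E] [Module R E] [TopologicalSpace E]
    [AddCommMonoid F] [Module R F] [TopologicalSpace F]
    (f : E →L[R] F) {s : Set E} {p : Submodule R F} (hp : IsClosed (p : Set F))
    (h : ∀ x ∈ s, f x ∈ p) {x : E} (hx : x ∈ closure (Submodule.span R s : Set E)) : f x ∈ p :=
  closure_minimal (t := (p.comap f.toLinearMap : Set E))
    (Submodule.span_le.2 h) (hp.preimage f.continuous) hx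

/-- Let `H`, `K` be complex Hilbert spaces, `A ⊆ B(H)` and `B ⊆ B(K)`
C*-subalgebras (norm-closed star subalgebras), and `X ⊆ B(K,H)` a norm-closed subspace with
(i) `A X ⊆ X`, (ii) `X B ⊆ X`, (iii) `X* X ⊆ B`, (iv) the closed span of `A X` equals `X`.
If moreover there is `Y ⊆ B(H,K)` with the closed span of `{S R : S ∈ X, R ∈ Y}` equal
to `A`, then `S₁ S₂* ∈ A` for all `S₁, S₂ ∈ X`. -/
theorem stmt5 {H K : Type*}
    [NormedAddCommGroup H] [InnerProductSpace ℂ H] [CompleteSpace H]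
    [NormedAddCommGroup K] [InnerProductSpace ℂ K] [CompleteSpace K]
    (A : NonUnitalStarSubalgebra ℂ (H →L[ℂ] H)) (hA : IsClosed (A : Set (H →L[ℂ] H)))
    (B : NonUnitalStarSubalgebra ℂ (K →L[ℂ] K)) (hB : IsClosed (B : Set (K →L[ℂ] K)))
    (X : Submodule ℂ (K →L[ℂ] H)) (hX : IsClosed (X : Set (K →L[ℂ] H)))
    (h1 : ∀ a ∈ A, ∀ S ∈ X, a.comp S ∈ X)
    (h2 : ∀ S ∈ X, ∀ b ∈ B, S.comp b ∈ X)
    (h3 : ∀ S₁ ∈ X, ∀ S₂ ∈ X, (ContinuousLinearMap.adjoint S₁).comp S₂ ∈ B)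
    (h4 : closure (↑(Submodule.span ℂ
        {x : K →L[ℂ] H | ∃ a ∈ A, ∃ S ∈ X, x = a.comp S}) : Set (K →L[ℂ] H))
      = (X : Set (K →L[ℂ] H)))
    (Y : Set (H →L[ℂ] K))
    (hY : closure (↑(Submodule.span ℂ
        {x : H →L[ℂ] H | ∃ S ∈ X, ∃ R ∈ Y, x = S.comp R}) : Set (H →L[ℂ] H))
      = (A : Set (H →L[ℂ] H))) :
    ∀ S₁ ∈ X, ∀ S₂ ∈ X, S₁.comp (ContinuousLinearMap.adjoint S₂) ∈ A := by
  have hXY : ∀ S ∈ X, ∀ R ∈ Y, S.comp R ∈ A := fun S hS R hR ↦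
    hY.subset (subset_closure (Submodule.subset_span ⟨S, hS, R, hR, rfl⟩))
  have hXXA : ∀ S₁ ∈ X, ∀ S₂ ∈ X, ∀ a ∈ A,
      (S₁.comp (ContinuousLinearMap.adjoint S₂)).comp a ∈ A := by
    intro S₁ hS₁ S₂ hS₂ a ha
    refine (ContinuousLinearMap.compL ℂ H H H
      (S₁.comp (ContinuousLinearMap.adjoint S₂))).map_mem_of_mem_closure_span
      (p := A.toSubmodule) hA ?_ (hY.superset ha)
    rintro _ ⟨S, hS, R, hR, rfl⟩
    exact hXY _ (h2 S₁ hS₁ _ (h3 S₂ hS₂ S hS)) R hR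
  intro S₁ hS₁ S₂ hS₂
  refine ((ContinuousLinearMap.compL ℂ H K H).flip
    (ContinuousLinearMap.adjoint S₂)).map_mem_of_mem_closure_span
    (p := A.toSubmodule) hA ?_ (h4.superset hS₁)
  rintro _ ⟨a, ha, S, hS, rfl⟩
  have h := star_mem (hXXA S₂ hS₂ S hS (star a) (star_mem ha))
  simpa [ContinuousLinearMap.star_eq_adjoint, ContinuousLinearMap.adjoint_comp,
    ContinuousLinearMap.comp_assoc] using h
end
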